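/- There is no normal form alternation-trading proof for c = 2 with at least two lines. -/

import Mathlib

/-- A quantifier block `(Q n^a)^b`: a quantifier label `Q` (`true` = ∃, `false` = ∀),
the guess exponent `a`, and the input exponent `b` written to its right
(so the block for `Q_i` carries `b_{i+1}`). -/
structure Block where
  Q : Bool
  a : ℝ
  b : ℝ

/-- A line `(Q_1 n^{a_1})^{b_2} (Q_2 n^{a_2})^{b_3} ⋯ (Q_k n^{a_k})^{b_{k+1}} DTS[n^{a_{k+1}}]`.
The quantifier blocks are listed *innermost first*, i.e.
`blocks = [(Q_k, a_k, b_{k+1}), …, (Q_1, a_1, b_2)]`, and `dts = a_{k+1}`. -/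
structure Line where
  blocks : List Block
  dts : ℝ

/-- Well-formedness of a line: `a_{k+1} ≥ 1`, all `a_i ≥ 0`, all `b_i ≥ 1`, and
adjacent quantifiers alternate (`Q_i ≠ Q_{i+1}`). -/
def Line.WF (L : Line) : Prop :=
  1 ≤ L.dts ∧ (∀ B ∈ L.blocks, 0 ≤ B.a ∧ 1 ≤ B.b) ∧
    L.blocks.Chain' (fun B B' => B.Q ≠ B'.Q)

/-- Reading off `b_k` from the list of blocks outside block `k`:
by convention `b_1 = 1` when no blocks remain. -/
def prevB : List Block → ℝ
  | [] => 1
  | B :: _ => B.b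

/-- Speedup Rule 0: from `DTS[n^{a₁}]` (k = 0), for any `0 < x < a₁` and `Q₀`,
derive `(Q₀ n^x)^{max(x,1)} (Q₁ n^0)^1 DTS[n^{max(a₁ - x, 1)}]` with `Q₁ ≠ Q₀`. -/
inductive Speedup0 : Line → Line → Prop
  | intro (a₁ x : ℝ) (Q : Bool) (h0 : 0 < x) (h1 : x < a₁) :
      Speedup0 ⟨[], a₁⟩ ⟨[⟨!Q, 0, 1⟩, ⟨Q, x, max x 1⟩], max (a₁ - x) 1⟩

/-- Speedup Rule 1: from `⋯ (Q_k n^{a_k})^{b_{k+1}} DTS[n^{a_{k+1}}]` (k > 0), for any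
`0 < x < a_{k+1}`, derive
`⋯ (Q_k n^{max(a_k,x)})^{max(x,b_{k+1})} (Q_{k+1} n^0)^{b_{k+1}} DTS[n^{max(a_{k+1} - x, 1)}]`
with `Q_{k+1} ≠ Q_k`. -/
inductive Speedup1 : Line → Line → Prop
  | intro (Qk : Bool) (ak bk1 a x : ℝ) (rest : List Block) (h0 : 0 < x) (h1 : x < a) :
      Speedup1 ⟨⟨Qk, ak, bk1⟩ :: rest, a⟩
        ⟨⟨!Qk, 0, bk1⟩ :: ⟨Qk, max ak x, max x bk1⟩ :: rest, max (a - x) 1⟩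

/-- Speedup Rule 2: from `⋯ (Q_k n^{a_k})^{b_{k+1}} DTS[n^{a_{k+1}}]` (k > 0), for any
`0 < x < a_{k+1}`, derive
`⋯ (Q_k n^{a_k})^{b_{k+1}} (Q_{k+1} n^x)^{max(x,b_{k+1})} (Q_{k+2} n^0)^{b_{k+1}}
DTS[n^{max(a_{k+1} - x, 1)}]` with `Q_{k+1} ≠ Q_k`, `Q_{k+2} ≠ Q_{k+1}`. -/
inductive Speedup2 : Line → Line → Prop
  | intro (Qk : Bool) (ak bk1 a x : ℝ) (rest : List Block) (h0 : 0 < x) (h1 : x < a) :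
      Speedup2 ⟨⟨Qk, ak, bk1⟩ :: rest, a⟩
        ⟨⟨Qk, 0, bk1⟩ :: ⟨!Qk, x, max x bk1⟩ :: ⟨Qk, ak, bk1⟩ :: rest, max (a - x) 1⟩

/-- A speedup step: an application of Speedup Rule 0, 1 or 2. -/
def SpeedupStep (L L' : Line) : Prop := Speedup0 L L' ∨ Speedup1 L L' ∨ Speedup2 L L'

/-- Slowdown Rule: from `⋯ (Q_{k-1} n^{a_{k-1}})^{b_k} (Q_k n^{a_k})^{b_{k+1}} DTS[n^{a_{k+1}}]`
(k > 0) derive `⋯ (Q_{k-1} n^{a_{k-1}})^{b_k} DTS[n^{c · max(a_{k+1}, a_k, b_k, b_{k+1})}]`,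
with the convention `b_1 = 1`. -/
inductive Slowdown (c : ℝ) : Line → Line → Prop
  | intro (Qk : Bool) (ak bk1 a : ℝ) (rest : List Block) :
      Slowdown c ⟨⟨Qk, ak, bk1⟩ :: rest, a⟩
        ⟨rest, c * max (max a ak) (max (prevB rest) bk1)⟩

/-- A step of an alternation-trading proof for `c`. -/
def Step (c : ℝ) (L L' : Line) : Prop := SpeedupStep L L' ∨ Slowdown c L L'

/-- An alternation-trading proof for `c`: a nonempty list of well-formed lines in which
each line after the first follows from the previous one by a Speedup or Slowdown Rule. -/
def IsATProof (c : ℝ) (P : List Line) : Prop :=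
  P ≠ [] ∧ (∀ L ∈ P, L.WF) ∧ P.Chain' (Step c)

/-- Normal form: the first line is `DTS[n^a]`, the last line is `DTS[n^{a'}]` with `a ≥ a'`,
and no intermediate line is a `DTS` class (i.e. has `k = 0`). -/
def IsNormalForm (P : List Line) : Prop :=
  (∃ a a' : ℝ, a' ≤ a ∧ P.head? = some ⟨[], a⟩ ∧ P.getLast? = some ⟨[], a'⟩) ∧
    ∀ i L, 0 < i → i + 1 < P.length → P[i]? = some L → L.blocks ≠ []

/-- `A` is the annotation of the proof `P`: `A` has one bit per step of `P`
(bit `A[i]` governs the step from line `i` to line `i+1`, 0-indexed), a `true` bit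
marks a Speedup Rule application and a `false` bit a Slowdown Rule application. -/
def HasAnnotation (c : ℝ) (P : List Line) (A : List Bool) : Prop :=
  A.length + 1 = P.length ∧
    ∀ i L L', P[i]? = some L → P[i + 1]? = some L' →
      (A[i]? = some true → SpeedupStep L L') ∧ (A[i]? = some false → Slowdown c L L')

/-- The exponent reached from the given blocks and `DTS` exponent by slowing down (with `c = 2`)
until no quantifier block is left. -/
noncomputable def slowdownExponent : List Block → ℝ → ℝ
  | [], t => t
  | B :: rest, t =>
      slowdownExponent rest (2 * max (max t B.a) (max (prevB rest) B.b))

theorem slowdownExponent_mono (l : List Block) : Monotone (slowdownExponent l) := by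
  induction l with
  | nil => exact fun _ _ h => h
  | cons B rest ih =>
    intro s t h
    simp only [slowdownExponent]
    exact ih (by gcongr)

theorem slowdownExponent_cons_le {B B' : Block} {rest : List Block} {t t' : ℝ}
    (ha : B.a ≤ B'.a) (hb : B.b ≤ B'.b) (ht : t ≤ t') :
    slowdownExponent (B :: rest) t ≤ slowdownExponent (B' :: rest) t' := by
  simp only [slowdownExponent]
  exact slowdownExponent_mono rest (by gcongr)

/-- One slowdown undoes the gain of a speedup by `x`. -/
theorem le_two_mul_max_of_speedup (a x u v w : ℝ) :
    a ≤ 2 * max (max (max (a - x) 1) u) (max (max x v) w) := by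
  have h₁ : a - x ≤ max (max (max (a - x) 1) u) (max (max x v) w) := by simp
  have h₂ : x ≤ max (max (max (a - x) 1) u) (max (max x v) w) := by simp
  linarith

theorem lt_slowdownExponent_of_speedup0 {L L' : Line} (h : Speedup0 L L') :
    slowdownExponent L.blocks L.dts < slowdownExponent L'.blocks L'.dts := by
  obtain ⟨a, x, Q, h0, h1⟩ := h
  simp only [slowdownExponent, prevB]
  have h₁ := le_two_mul_max_of_speedup a x 0 1 1
  set s := 2 * max (max (max (a - x) 1) 0) (max (max x 1) 1)
  have h₂ : s ≤ max (max s x) (max 1 (max x 1)) := by simp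
  linarith

theorem slowdownExponent_le_of_step {L L' : Line} (h : Step 2 L L') :
    slowdownExponent L.blocks L.dts ≤ slowdownExponent L'.blocks L'.dts := by
  rcases h with (h | h | h) | h
  · exact (lt_slowdownExponent_of_speedup0 h).le
  · obtain ⟨Q, ak, b, a, x, rest, h0, h1⟩ := h
    rw [slowdownExponent]
    exact slowdownExponent_cons_le (le_max_left _ _) (le_max_right _ _)
      (le_two_mul_max_of_speedup a x 0 b b)
  · obtain ⟨Q, ak, b, a, x, rest, h0, h1⟩ := h
    rw [slowdownExponent, slowdownExponent]
    refine slowdownExponent_cons_le le_rfl le_rfl ?_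
    simp only [prevB]
    have h₁ := le_two_mul_max_of_speedup a x 0 b b
    set s := 2 * max (max (max (a - x) 1) 0) (max (max x b) b)
    have h₂ : s ≤ max (max s x) (max b (max x b)) := by simp
    linarith
  · obtain ⟨Q, ak, b, a, rest⟩ := h
    exact le_rfl

theorem slowdownExponent_le_getLast (l : List Line) (L : Line)
    (h : (L :: l).IsChain (Step 2)) {M : Line} (hM : (L :: l).getLast? = some M) :
    slowdownExponent L.blocks L.dts ≤ slowdownExponent M.blocks M.dts := by
  induction l generalizing L with
  | nil =>
    obtain rfl : L = M := by simpa using hM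
    exact le_rfl
  | cons K l ih =>
    rw [List.isChain_cons_cons] at h
    rw [List.getLast?_cons_cons] at hM
    exact (slowdownExponent_le_of_step h.1).trans (ih K h.2 hM)

/-- there is no normal form alternation-trading proof for `c = 2`
with at least two lines. -/
theorem statement3 :
    ¬ ∃ P : List Line, IsATProof 2 P ∧ IsNormalForm P ∧ 2 ≤ P.length := by
  rintro ⟨P, ⟨-, -, hP⟩, ⟨⟨a, a', haa', hhead, hlast⟩, -⟩, hlen⟩
  match P, hlen with
  | L :: K :: l, _ =>
    obtain rfl : L = ⟨[], a⟩ := by simpa using hhead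
    obtain ⟨hstep, htail⟩ := List.isChain_cons_cons.1 hP
    rw [List.getLast?_cons_cons] at hlast
    have hle : slowdownExponent K.blocks K.dts ≤ a' :=
      slowdownExponent_le_getLast l K htail hlast
    have hlt : a < slowdownExponent K.blocks K.dts := by
      rcases hstep with (h | h | h) | h
      · exact lt_slowdownExponent_of_speedup0 h
      all_goals cases h
    linarith
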